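/- If (H, r) is a quasitriangular Hopf algebra, then the antipode S_H is bijective and (H, r, id_H, S_H⁻²) is an oriented quantum algebra. -/

import Mathlib

open TensorProduct

noncomputable section

namespace OQApaper

variable (K : Type*) [Field K]

section Maps

variable (A B C D : Type*) [Ring A] [Ring B] [Ring C] [Ring D]
  [Algebra K A] [Algebra K B] [Algebra K C] [Algebra K D]

/-- The linear embedding `A ⊗ B → A ⊗ Bᵐᵒᵖ` (identity on the first factor, `op` on the
second), used to phrase statements about products in `H ⊗ H'^op`. -/
def opify : A ⊗[K] B →ₗ[K] A ⊗[K] Bᵐᵒᵖ :=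
  TensorProduct.map LinearMap.id (MulOpposite.opLinearEquiv K).toLinearMap

/-- `a ⊗ b ↦ a ⊗ b ⊗ 1` into `A ⊗ (B ⊗ C)`. -/
def emb12 : A ⊗[K] B →ₐ[K] A ⊗[K] (B ⊗[K] C) :=
  Algebra.TensorProduct.map (AlgHom.id K A) Algebra.TensorProduct.includeLeft

/-- `a ⊗ c ↦ a ⊗ 1 ⊗ c` into `A ⊗ (B ⊗ C)`. -/
def emb13 : A ⊗[K] C →ₐ[K] A ⊗[K] (B ⊗[K] C) :=
  Algebra.TensorProduct.map (AlgHom.id K A) Algebra.TensorProduct.includeRight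

/-- `b ⊗ c ↦ 1 ⊗ b ⊗ c` into `A ⊗ (B ⊗ C)`. -/
def emb23 : B ⊗[K] C →ₐ[K] A ⊗[K] (B ⊗[K] C) :=
  Algebra.TensorProduct.includeRight

/-- `b ⊗ a ↦ a ⊗ b ⊗ 1` into `A ⊗ (B ⊗ C)` (swapped version of `emb12`). -/
def emb21 : B ⊗[K] A →ₐ[K] A ⊗[K] (B ⊗[K] C) :=
  (emb12 K A B C).comp (Algebra.TensorProduct.comm K B A).toAlgHom

/-- `c ⊗ b ↦ 1 ⊗ b ⊗ c` into `A ⊗ (B ⊗ C)` (swapped version of `emb23`). -/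
def emb32 : C ⊗[K] B →ₐ[K] A ⊗[K] (B ⊗[K] C) :=
  (emb23 K A B C).comp (Algebra.TensorProduct.comm K C B).toAlgHom

/-- `a ⊗ c ↦ (a ⊗ 1) ⊗ (c ⊗ 1)` into `(A ⊗ B) ⊗ (C ⊗ D)`. -/
def E13 : A ⊗[K] C →ₐ[K] (A ⊗[K] B) ⊗[K] (C ⊗[K] D) :=
  Algebra.TensorProduct.map Algebra.TensorProduct.includeLeft
    Algebra.TensorProduct.includeLeft

/-- `a ⊗ d ↦ (a ⊗ 1) ⊗ (1 ⊗ d)` into `(A ⊗ B) ⊗ (C ⊗ D)`. -/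
def E14 : A ⊗[K] D →ₐ[K] (A ⊗[K] B) ⊗[K] (C ⊗[K] D) :=
  Algebra.TensorProduct.map Algebra.TensorProduct.includeLeft
    Algebra.TensorProduct.includeRight

/-- `b ⊗ d ↦ (1 ⊗ b) ⊗ (1 ⊗ d)` into `(A ⊗ B) ⊗ (C ⊗ D)`. -/
def E24 : B ⊗[K] D →ₐ[K] (A ⊗[K] B) ⊗[K] (C ⊗[K] D) :=
  Algebra.TensorProduct.map Algebra.TensorProduct.includeRight
    Algebra.TensorProduct.includeRight

/-- `b ⊗ c ↦ (1 ⊗ b) ⊗ (c ⊗ 1)` into `(A ⊗ B) ⊗ (C ⊗ D)`. -/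
def E23 : B ⊗[K] C →ₐ[K] (A ⊗[K] B) ⊗[K] (C ⊗[K] D) :=
  Algebra.TensorProduct.map Algebra.TensorProduct.includeRight
    Algebra.TensorProduct.includeLeft

/-- `c ⊗ b ↦ (1 ⊗ b) ⊗ (c ⊗ 1)` into `(A ⊗ B) ⊗ (C ⊗ D)` (swapped `E23`). -/
def E32 : C ⊗[K] B →ₐ[K] (A ⊗[K] B) ⊗[K] (C ⊗[K] D) :=
  (E23 K A B C D).comp (Algebra.TensorProduct.comm K C B).toAlgHom

end Maps

section Defs

variable {A B : Type*} [Ring A] [Ring B] [Algebra K A] [Algebra K B]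

/-- An oriented quantum algebra `(A, r, σ, τ)` (Definition 1.1), with the inverse `ri`
of `r` given explicitly:  `σ, τ` are commuting algebra automorphisms, `(σ ⊗ id)(r⁻¹)`
and `(id ⊗ τ)(r)` are inverses in `A ⊗ Aᵐᵒᵖ`, `(σ ⊗ σ)(r) = r = (τ ⊗ τ)(r)`, and `r`
satisfies the quantum Yang–Baxter equation. -/
structure IsOQA (r ri : A ⊗[K] A) (σ τ : A ≃ₐ[K] A) : Prop where
  comm_auto : ∀ a : A, σ (τ a) = τ (σ a)
  mul_inv : r * ri = 1
  inv_mul : ri * r = 1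
  op_mul_inv :
    opify K A A (Algebra.TensorProduct.map σ.toAlgHom (AlgHom.id K A) ri) *
      opify K A A (Algebra.TensorProduct.map (AlgHom.id K A) τ.toAlgHom r) = 1
  op_inv_mul :
    opify K A A (Algebra.TensorProduct.map (AlgHom.id K A) τ.toAlgHom r) *
      opify K A A (Algebra.TensorProduct.map σ.toAlgHom (AlgHom.id K A) ri) = 1
  map_sigma : Algebra.TensorProduct.map σ.toAlgHom σ.toAlgHom r = r
  map_tau : Algebra.TensorProduct.map τ.toAlgHom τ.toAlgHom r = r
  qybe : emb12 K A A A r * emb13 K A A A r * emb23 K A A A r =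
    emb23 K A A A r * emb13 K A A A r * emb12 K A A A r

/-- An OQA nonuple `(A, B, p, p', r, σ, τ, σ', τ')` (Definition 3.1), with explicit
inverses `pinv, p'inv, rinv`. -/
structure IsOQANonuple (p pinv : A ⊗[K] A) (p' p'inv : B ⊗[K] B) (r rinv : A ⊗[K] B)
    (σ τ : A ≃ₐ[K] A) (σ' τ' : B ≃ₐ[K] B) : Prop where
  comm_auto : ∀ a : A, σ (τ a) = τ (σ a)
  comm_auto' : ∀ b : B, σ' (τ' b) = τ' (σ' b)
  p_mul_inv : p * pinv = 1
  p_inv_mul : pinv * p = 1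
  p'_mul_inv : p' * p'inv = 1
  p'_inv_mul : p'inv * p' = 1
  r_mul_inv : r * rinv = 1
  r_inv_mul : rinv * r = 1
  op_mul_inv :
    opify K A B (Algebra.TensorProduct.map σ.toAlgHom (AlgHom.id K B) rinv) *
      opify K A B (Algebra.TensorProduct.map (AlgHom.id K A) τ'.toAlgHom r) = 1
  op_inv_mul :
    opify K A B (Algebra.TensorProduct.map (AlgHom.id K A) τ'.toAlgHom r) *
      opify K A B (Algebra.TensorProduct.map σ.toAlgHom (AlgHom.id K B) rinv) = 1
  map_sigma : Algebra.TensorProduct.map σ.toAlgHom σ'.toAlgHom r = r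
  map_tau : Algebra.TensorProduct.map τ.toAlgHom τ'.toAlgHom r = r
  cond3 : emb12 K A A B p * emb13 K A A B r * emb23 K A A B r =
    emb23 K A A B r * emb13 K A A B r * emb12 K A A B p
  cond4 : emb12 K A B B r * emb13 K A B B r * emb23 K A B B p' =
    emb23 K A B B p' * emb13 K A B B r * emb12 K A B B r

end Defs

section BialgDefs

variable {A B : Type*} [Ring A] [Ring B] [Bialgebra K A] [Bialgebra K B]

/-- A weak R-matrix of `(A, B)` (Definition 2.6):  an invertible `r ∈ A ⊗ B` with
`(Δ ⊗ id)(r) = r₁₃ r₂₃` and `(id ⊗ Δ)(r) = r₁₃ r₁₂`. -/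
structure IsWeakR (r : A ⊗[K] B) : Prop where
  isUnit : IsUnit r
  comul_left :
    TensorProduct.assoc K A A B
        (TensorProduct.map (Coalgebra.comul (R := K)) LinearMap.id r) =
      emb13 K A A B r * emb23 K A A B r
  comul_right :
    TensorProduct.map LinearMap.id (Coalgebra.comul (R := K)) r =
      emb13 K A B B r * emb12 K A B B r

/-- A quasitriangular structure `p` on a bialgebra `A` (Definition 2.4). -/
structure IsQT (p : A ⊗[K] A) : Prop where
  comul_left :
    TensorProduct.assoc K A A A
        (TensorProduct.map (Coalgebra.comul (R := K)) LinearMap.id p) =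
      emb13 K A A A p * emb23 K A A A p
  comul_right :
    TensorProduct.map LinearMap.id (Coalgebra.comul (R := K)) p =
      emb13 K A A A p * emb12 K A A A p
  almost_cocomm : ∀ h : A,
    TensorProduct.comm K A A (Coalgebra.comul (R := K) h) * p =
      p * Coalgebra.comul (R := K) h
  counit_left :
    TensorProduct.lid K A
      (TensorProduct.map (Coalgebra.counit (R := K)) LinearMap.id p) = 1
  counit_right :
    TensorProduct.rid K A
      (TensorProduct.map LinearMap.id (Coalgebra.counit (R := K)) p) = 1

end BialgDefs

end OQApaper

namespace OQApaper

open Coalgebra HopfAlgebra LinearMap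

section Bialgebra

variable {K A : Type*} [Field K] [Ring A] [Bialgebra K A] {p : A ⊗[K] A}

/-- Applying a convolution identity in the second leg of a quasitriangular structure. -/
theorem IsQT.map_right_eq_one (hp : IsQT K p) {L : A ⊗[K] A →ₗ[K] A}
    (hL : L ∘ₗ comul = Algebra.linearMap K A ∘ₗ counit) :
    TensorProduct.map LinearMap.id L (emb13 K A A A p * emb12 K A A A p) = 1 := by
  rw [← hp.comul_right, ← LinearMap.comp_apply, ← TensorProduct.map_comp, hL,
    LinearMap.comp_id, Algebra.TensorProduct.one_def]
  have h (q : A ⊗[K] A) :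
      TensorProduct.map LinearMap.id (Algebra.linearMap K A ∘ₗ counit) q =
        TensorProduct.rid K A (TensorProduct.map LinearMap.id counit q) ⊗ₜ 1 := by
    induction q with
    | zero => simp
    | tmul a b => simp [Algebra.algebraMap_eq_smul_one, TensorProduct.smul_tmul]
    | add x y hx hy => simp only [map_add, hx, hy, TensorProduct.add_tmul]
  rw [h, hp.counit_right]

/-- Applying a convolution identity in the first leg of a quasitriangular structure. -/
theorem IsQT.map_left_eq_one (hp : IsQT K p) {L : A ⊗[K] A →ₗ[K] A}
    (hL : L ∘ₗ comul = Algebra.linearMap K A ∘ₗ counit) :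
    TensorProduct.map L LinearMap.id
      ((TensorProduct.assoc K A A A).symm (emb13 K A A A p * emb23 K A A A p)) = 1 := by
  rw [← hp.comul_left, LinearEquiv.symm_apply_apply, ← LinearMap.comp_apply,
    ← TensorProduct.map_comp, hL, LinearMap.comp_id, Algebra.TensorProduct.one_def]
  have h (q : A ⊗[K] A) :
      TensorProduct.map (Algebra.linearMap K A ∘ₗ counit) LinearMap.id q =
        1 ⊗ₜ TensorProduct.lid K A (TensorProduct.map counit LinearMap.id q) := by
    induction q with
    | zero => simp
    | tmul a b => simp [Algebra.algebraMap_eq_smul_one, TensorProduct.smul_tmul]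
    | add x y hx hy => simp only [map_add, hx, hy, TensorProduct.tmul_add]
  rw [h, hp.counit_left]

/-- A quasitriangular structure satisfies the quantum Yang-Baxter equation. -/
theorem IsQT.qybe (hp : IsQT K p) :
    emb12 K A A A p * emb13 K A A A p * emb23 K A A A p =
      emb23 K A A A p * emb13 K A A A p * emb12 K A A A p := by
  let α := Algebra.TensorProduct.assoc K K K A A A
  let φ := (α.symm.trans (Algebra.TensorProduct.congr
    (Algebra.TensorProduct.comm K A A) AlgEquiv.refl)).trans α
  have h12 (q : A ⊗[K] A) : emb12 K A A A q = α (q ⊗ₜ 1) := by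
    induction q with
    | zero => simp
    | tmul a b => simp [emb12, α]
    | add x y hx hy => simp only [map_add, hx, hy, TensorProduct.add_tmul]
  have h13 (q : A ⊗[K] A) : φ (emb13 K A A A q) = emb23 K A A A q := by
    induction q with
    | zero => simp
    | tmul a b => simp [emb13, emb23, φ, α]
    | add x y hx hy => simp only [map_add, hx, hy]
  have h23 (q : A ⊗[K] A) : φ (emb23 K A A A q) = emb13 K A A A q := by
    induction q with
    | zero => simp
    | tmul a b => simp [emb13, emb23, φ, α]
    | add x y hx hy => simp only [map_add, hx, hy]
  have key (q : A ⊗[K] A) :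
      emb12 K A A A p * TensorProduct.assoc K A A A (TensorProduct.map comul LinearMap.id q) =
        φ (TensorProduct.assoc K A A A (TensorProduct.map comul LinearMap.id q)) *
          emb12 K A A A p := by
    induction q with
    | zero => simp
    | tmul a b =>
      have e : TensorProduct.assoc K A A A (comul a ⊗ₜ b) = α (comul a ⊗ₜ b) := rfl
      have e' : φ (α (comul a ⊗ₜ b)) = α (TensorProduct.comm K A A (comul a) ⊗ₜ b) := by
        simp [φ]
        rfl
      rw [TensorProduct.map_tmul, LinearMap.id_apply, e, e', h12, ← map_mul, ← map_mul,
        Algebra.TensorProduct.tmul_mul_tmul, Algebra.TensorProduct.tmul_mul_tmul,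
        hp.almost_cocomm, one_mul, mul_one]
    | add x y hx hy => simp only [map_add, mul_add, add_mul, hx, hy]
  have := key p
  rwa [hp.comul_left, map_mul, h13, h23, ← mul_assoc] at this

end Bialgebra

section HopfAlgebra

variable {K A : Type*} [Field K] [Ring A] [HopfAlgebra K A] {s : Finset (A × A)}

local notation "S" => antipode K (A := A)

theorem IsQT.sum_mul_antipode_tmul (hp : IsQT K (∑ i ∈ s, i.1 ⊗ₜ[K] i.2)) :
    ∑ i ∈ s, ∑ j ∈ s, (i.1 * S j.1) ⊗ₜ[K] (i.2 * j.2) = 1 := by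
  have h := hp.map_left_eq_one (L := LinearMap.mul' K A ∘ₗ LinearMap.lTensor A S)
    mul_antipode_lTensor_comul
  simpa [emb13, emb23, Finset.sum_mul_sum] using h

theorem IsQT.sum_antipode_mul_tmul (hp : IsQT K (∑ i ∈ s, i.1 ⊗ₜ[K] i.2)) :
    ∑ i ∈ s, ∑ j ∈ s, (S i.1 * j.1) ⊗ₜ[K] (i.2 * j.2) = 1 := by
  have h := hp.map_left_eq_one (L := LinearMap.mul' K A ∘ₗ LinearMap.rTensor A S)
    mul_antipode_rTensor_comul
  simpa [emb13, emb23, Finset.sum_mul_sum] using h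

theorem IsQT.sum_tmul_antipode_mul (hp : IsQT K (∑ i ∈ s, i.1 ⊗ₜ[K] i.2)) :
    ∑ i ∈ s, ∑ j ∈ s, (i.1 * j.1) ⊗ₜ[K] (S j.2 * i.2) = 1 := by
  have h := hp.map_right_eq_one (L := LinearMap.mul' K A ∘ₗ LinearMap.rTensor A S)
    mul_antipode_rTensor_comul
  simpa [emb13, emb12, Finset.sum_mul_sum] using h

theorem IsQT.sum_tmul_mul_antipode (hp : IsQT K (∑ i ∈ s, i.1 ⊗ₜ[K] i.2)) :
    ∑ i ∈ s, ∑ j ∈ s, (i.1 * j.1) ⊗ₜ[K] (j.2 * S i.2) = 1 := by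
  have h := hp.map_right_eq_one (L := LinearMap.mul' K A ∘ₗ LinearMap.lTensor A S)
    mul_antipode_lTensor_comul
  simpa [emb13, emb12, Finset.sum_mul_sum] using h

/-- A quasitriangular structure is invariant under `S ⊗ S`. -/
theorem IsQT.map_antipode (hp : IsQT K (∑ i ∈ s, i.1 ⊗ₜ[K] i.2)) :
    ∑ i ∈ s, S i.1 ⊗ₜ[K] S i.2 = ∑ i ∈ s, i.1 ⊗ₜ[K] i.2 := by
  have h := congrArg (TensorProduct.map S LinearMap.id) hp.sum_tmul_antipode_mul
  rw [Finset.sum_comm] at h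
  refine left_inv_eq_right_inv (a := ∑ i ∈ s, S i.1 ⊗ₜ[K] i.2) ?_ ?_
  · simpa [Finset.sum_mul_sum, antipode_mul_antidistrib, Algebra.TensorProduct.one_def] using h
  · simpa [Finset.sum_mul_sum] using hp.sum_antipode_mul_tmul

variable (K s) in
/-- The Drinfeld element `∑ S(bᵢ) aᵢ` of `∑ aᵢ ⊗ bᵢ`. -/
def drinfeld : A := ∑ i ∈ s, S i.2 * i.1

variable (K s) in
/-- The element `∑ bᵢ S²(aᵢ)`, inverse to the Drinfeld element. -/
def drinfeldInv : A := ∑ i ∈ s, i.2 * S (S i.1)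

local notation "u" => drinfeld K s
local notation "v" => drinfeldInv K s

theorem IsQT.antipode_mul_drinfeld_mul (hp : IsQT K (∑ i ∈ s, i.1 ⊗ₜ[K] i.2)) (x : A) :
    TensorProduct.lift ((LinearMap.mul K A).flip.compl₂ (LinearMap.mulRight K u ∘ₗ S))
      (comul x) = counit (R := K) x • u := by
  let G : A ⊗[K] A →ₗ[K] A := TensorProduct.lift ((LinearMap.mul K A).flip.compl₂ S)
  have h₁ (t : A ⊗[K] A) : G ((∑ i ∈ s, i.1 ⊗ₜ[K] i.2) * t) =
      TensorProduct.lift ((LinearMap.mul K A).flip.compl₂ (LinearMap.mulRight K u ∘ₗ S)) t := by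
    induction t with
    | zero => simp
    | tmul a b =>
      simp [G, Finset.sum_mul, Finset.mul_sum, antipode_mul_antidistrib, drinfeld, mul_assoc]
    | add x y hx hy => simp only [map_add, mul_add, hx, hy]
  have h₂ (t : A ⊗[K] A) : G (TensorProduct.comm K A A t * (∑ i ∈ s, i.1 ⊗ₜ[K] i.2)) =
      ∑ i ∈ s, S i.2 * LinearMap.mul' K A (LinearMap.rTensor A S t) * i.1 := by
    induction t with
    | zero => simp
    | tmul a b => simp [G, Finset.mul_sum, antipode_mul_antidistrib, mul_assoc]
    | add x y hx hy => simp only [map_add, mul_add, add_mul, hx, hy, Finset.sum_add_distrib]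
  rw [← h₁, ← hp.almost_cocomm, h₂, mul_antipode_rTensor_comul_apply]
  simp [drinfeld, Algebra.algebraMap_eq_smul_one, Finset.smul_sum]

/-- The square of the antipode is implemented by the Drinfeld element. -/
theorem IsQT.drinfeld_mul (hp : IsQT K (∑ i ∈ s, i.1 ⊗ₜ[K] i.2)) (h : A) :
    u * h = S (S h) * u := by
  let M : A ⊗[K] A →ₗ[K] A :=
    TensorProduct.lift ((LinearMap.mul K A).flip.compl₂ (LinearMap.mulRight K u ∘ₗ S))
  let N : A ⊗[K] A →ₗ[K] A := TensorProduct.lift ((LinearMap.mul K A).flip.compl₂ (S ∘ₗ S))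
  let T : A ⊗[K] (A ⊗[K] A) →ₗ[K] A :=
    N ∘ₗ TensorProduct.map M LinearMap.id ∘ₗ (TensorProduct.assoc K A A A).symm.toLinearMap
  have hl (t : A ⊗[K] A) : T (TensorProduct.assoc K A A A (comul.rTensor A t)) =
      S (S (TensorProduct.lid K A (counit.rTensor A t))) * u := by
    induction t with
    | zero => simp
    | tmul a b => simp [T, N, M, hp.antipode_mul_drinfeld_mul]
    | add x y hx hy => simp only [map_add, add_mul, hx, hy]
  have hr' (a : A) (t : A ⊗[K] A) :
      T (a ⊗ₜ t) = S (LinearMap.mul' K A (LinearMap.lTensor A S t)) * (u * a) := by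
    induction t with
    | zero => simp
    | tmul b c => simp [T, N, M, antipode_mul_antidistrib, mul_assoc]
    | add x y hx hy => simp only [map_add, TensorProduct.tmul_add, add_mul, hx, hy]
  have hr (t : A ⊗[K] A) : T (comul.lTensor A t) =
      u * TensorProduct.rid K A (counit.lTensor A t) := by
    induction t with
    | zero => simp
    | tmul a b => simp [hr', Algebra.algebraMap_eq_smul_one]
    | add x y hx hy => simp only [map_add, mul_add, hx, hy]
  have := hl (comul h)
  rw [coassoc_apply, hr] at this
  simpa using this

theorem IsQT.sum_mul_drinfeld_mul (hp : IsQT K (∑ i ∈ s, i.1 ⊗ₜ[K] i.2)) :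
    ∑ i ∈ s, i.2 * u * i.1 = 1 := by
  have h := congrArg (LinearMap.mul' K A ∘ₗ (TensorProduct.comm K A A).toLinearMap)
    hp.sum_tmul_mul_antipode
  rw [Finset.sum_comm] at h
  simpa [drinfeld, Finset.mul_sum, Finset.sum_mul, mul_assoc,
    Algebra.TensorProduct.one_def] using h

theorem IsQT.drinfeldInv_mul_drinfeld (hp : IsQT K (∑ i ∈ s, i.1 ⊗ₜ[K] i.2)) :
    v * u = 1 := by
  rw [← hp.sum_mul_drinfeld_mul, drinfeldInv, Finset.sum_mul]
  simp only [mul_assoc, hp.drinfeld_mul]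

theorem IsQT.map_antipode_antipode (hp : IsQT K (∑ i ∈ s, i.1 ⊗ₜ[K] i.2)) :
    ∑ i ∈ s, S (S i.1) ⊗ₜ[K] S (S i.2) = ∑ i ∈ s, i.1 ⊗ₜ[K] i.2 := by
  have h := congrArg (TensorProduct.map S S) hp.map_antipode
  simp only [map_sum, TensorProduct.map_tmul] at h
  exact h.trans hp.map_antipode

theorem IsQT.drinfeld_mul_drinfeldInv (hp : IsQT K (∑ i ∈ s, i.1 ⊗ₜ[K] i.2)) :
    u * v = 1 := by
  have h := congrArg (TensorProduct.lift
    ((LinearMap.mul K A).flip.compl₂ (LinearMap.mulRight K u))) hp.map_antipode_antipode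
  simp only [map_sum, TensorProduct.lift.tmul, LinearMap.compl₂_apply, LinearMap.flip_apply,
    LinearMap.mul_apply', LinearMap.mulRight_apply, hp.sum_mul_drinfeld_mul] at h
  rw [← h, drinfeldInv, Finset.mul_sum]
  exact Finset.sum_congr rfl fun i _ ↦ by rw [← mul_assoc, hp.drinfeld_mul]

theorem IsQT.drinfeld_conj (hp : IsQT K (∑ i ∈ s, i.1 ⊗ₜ[K] i.2)) (h : A) :
    u * h * v = S (S h) := by
  rw [hp.drinfeld_mul, mul_assoc, hp.drinfeld_mul_drinfeldInv, mul_one]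

/-- The inverse of the square of the antipode, as conjugation by the Drinfeld element. -/
def IsQT.antipodeSqInv (hp : IsQT K (∑ i ∈ s, i.1 ⊗ₜ[K] i.2)) : A ≃ₐ[K] A :=
  (AlgEquiv.ofLinearEquiv
    (LinearEquiv.ofLinearMap (S ∘ₗ S) (LinearMap.mulLeft K v ∘ₗ LinearMap.mulRight K u)
      (by
        ext h
        simp [← hp.drinfeld_conj, mul_assoc, hp.drinfeld_mul_drinfeldInv,
          ← mul_assoc (drinfeld K s) (drinfeldInv K s)])
      (by
        ext h
        simp [← hp.drinfeld_mul, ← mul_assoc, hp.drinfeldInv_mul_drinfeld]))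
    (by simp) (by simp [antipode_mul_antidistrib])).symm

theorem IsQT.antipode_antipode_antipodeSqInv (hp : IsQT K (∑ i ∈ s, i.1 ⊗ₜ[K] i.2)) (a : A) :
    S (S (hp.antipodeSqInv a)) = a :=
  hp.antipodeSqInv.symm_apply_apply a

theorem IsQT.antipodeSqInv_antipode_antipode (hp : IsQT K (∑ i ∈ s, i.1 ⊗ₜ[K] i.2)) (a : A) :
    hp.antipodeSqInv (S (S a)) = a :=
  hp.antipodeSqInv.apply_symm_apply a

theorem IsQT.sum_antipode_tmul (hp : IsQT K (∑ i ∈ s, i.1 ⊗ₜ[K] i.2)) :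
    ∑ i ∈ s, S i.1 ⊗ₜ[K] i.2 = ∑ i ∈ s, i.1 ⊗ₜ[K] hp.antipodeSqInv (S i.2) := by
  have h := congrArg (TensorProduct.map LinearMap.id (hp.antipodeSqInv.toLinearMap ∘ₗ S))
    hp.map_antipode
  simpa [hp.antipodeSqInv_antipode_antipode] using h

theorem IsQT.isOQA (hp : IsQT K (∑ i ∈ s, i.1 ⊗ₜ[K] i.2)) :
    IsOQA K (∑ i ∈ s, i.1 ⊗ₜ[K] i.2) (∑ i ∈ s, S i.1 ⊗ₜ[K] i.2) AlgEquiv.refl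
      hp.antipodeSqInv where
  comm_auto _ := rfl
  mul_inv := by simpa [Finset.sum_mul_sum] using hp.sum_mul_antipode_tmul
  inv_mul := by simpa [Finset.sum_mul_sum] using hp.sum_antipode_mul_tmul
  op_mul_inv := by
    have h := congrArg (TensorProduct.map LinearMap.id
      ((MulOpposite.opLinearEquiv K).toLinearMap ∘ₗ hp.antipodeSqInv.toLinearMap))
      hp.sum_tmul_mul_antipode
    rw [hp.sum_antipode_tmul]
    simpa [opify, Finset.sum_mul_sum, Algebra.TensorProduct.one_def] using h
  op_inv_mul := by
    have h := congrArg (TensorProduct.map LinearMap.id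
      ((MulOpposite.opLinearEquiv K).toLinearMap ∘ₗ hp.antipodeSqInv.toLinearMap))
      hp.sum_tmul_antipode_mul
    rw [hp.sum_antipode_tmul]
    simpa [opify, Finset.sum_mul_sum, Algebra.TensorProduct.one_def] using h
  map_sigma := by simp
  map_tau := by
    have h := congrArg (TensorProduct.map hp.antipodeSqInv.toLinearMap
      hp.antipodeSqInv.toLinearMap) hp.map_antipode_antipode
    simpa [hp.antipodeSqInv_antipode_antipode] using h.symm
  qybe := hp.qybe

end HopfAlgebra

end OQApaper

open OQApaper

/-- Remark 2.5: for a quasitriangular Hopf algebra `(H, r)`, the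
antipode is bijective and `(H, r, id_H, S_H⁻²)` is an OQA. -/
theorem qt_hopf_oqa (K : Type*) [Field K] (A : Type*) [Ring A] [HopfAlgebra K A]
    (p : A ⊗[K] A) (hp : IsQT K p) :
    Function.Bijective (HopfAlgebra.antipode (R := K) (A := A)) ∧
    ∃ (V : A ≃ₐ[K] A),
      (∀ a : A, HopfAlgebra.antipode (R := K) (HopfAlgebra.antipode (R := K) (V a)) = a) ∧
      (∀ a : A, V (HopfAlgebra.antipode (R := K) (HopfAlgebra.antipode (R := K) a)) = a) ∧
      ∃ pinv, IsOQA K p pinv AlgEquiv.refl V := by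
  obtain ⟨s, rfl⟩ := TensorProduct.exists_finset p
  exact ⟨⟨.of_comp (Function.LeftInverse.injective hp.antipodeSqInv_antipode_antipode),
      .of_comp (Function.RightInverse.surjective hp.antipode_antipode_antipodeSqInv)⟩,
    hp.antipodeSqInv, hp.antipode_antipode_antipodeSqInv, hp.antipodeSqInv_antipode_antipode,
    _, hp.isOQA⟩
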